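/- Let n ≥ 1, let ℓ denote the last index of Fin n, and let w : Fin n → ℝ satisfy 0 < w i ≤ w ℓ for every i. Let c : (Fin n →₀ ℕ) × (Fin n →₀ ℕ) →₀ ℂ be a finitely supported coefficient function and m : ℕ. Assume: (i) every pair (a, b) in the support of c satisfies ∑_i b i ≤ m, and (ii) the pair (0, Finsupp.single ℓ m) lies in the support of c. Then the maximum, over the support of c, of the weight ∑_i w i · ((b i : ℝ) − (a i : ℝ)) equals (w ℓ) · m; and a pair (a, b) in the support attains this maximum if and only if a = 0, ∑_i b i = m, and w i = w ℓ for every i with b i ≠ 0. In particular (0, Finsupp.single ℓ m) attains the maximum. -/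

import Mathlib

/-- The defect of the weight of `x^a ∂^b` from `w ℓ * m`, as a sum of three terms that are
nonnegative when `0 ≤ w i ≤ w ℓ` and `∑ i, b i ≤ m`. -/
theorem mul_sub_sum_weight {ι : Type*} [Fintype ι] (w : ι → ℝ) (ℓ : ι) (a b : ι →₀ ℕ) (m : ℕ) :
    w ℓ * m - ∑ i, w i * ((b i : ℝ) - (a i : ℝ)) =
      w ℓ * ((m : ℝ) - ((∑ i, b i : ℕ) : ℝ)) + ∑ i, (w ℓ - w i) * (b i : ℝ)
        + ∑ i, w i * (a i : ℝ) := by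
  simp only [mul_sub, sub_mul, Finset.sum_sub_distrib, Nat.cast_sum, Finset.mul_sum]
  ring

theorem sum_weight_le {ι : Type*} [Fintype ι] {w : ι → ℝ} {ℓ : ι} (hw_pos : ∀ i, 0 < w i)
    (hw_le : ∀ i, w i ≤ w ℓ) {a b : ι →₀ ℕ} {m : ℕ} (hb : ∑ i, b i ≤ m) :
    ∑ i, w i * ((b i : ℝ) - (a i : ℝ)) ≤ w ℓ * m := by
  have h₁ : 0 ≤ w ℓ * ((m : ℝ) - ((∑ i, b i : ℕ) : ℝ)) :=
    mul_nonneg (hw_pos ℓ).le (sub_nonneg.2 (Nat.cast_le.2 hb))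
  have h₂ : 0 ≤ ∑ i, (w ℓ - w i) * (b i : ℝ) :=
    Finset.sum_nonneg fun i _ => mul_nonneg (sub_nonneg.2 (hw_le i)) (Nat.cast_nonneg _)
  have h₃ : 0 ≤ ∑ i, w i * (a i : ℝ) :=
    Finset.sum_nonneg fun i _ => mul_nonneg (hw_pos i).le (Nat.cast_nonneg _)
  linarith [mul_sub_sum_weight w ℓ a b m]

theorem sum_weight_eq_iff {ι : Type*} [Fintype ι] {w : ι → ℝ} {ℓ : ι} (hw_pos : ∀ i, 0 < w i)
    (hw_le : ∀ i, w i ≤ w ℓ) {a b : ι →₀ ℕ} {m : ℕ} (hb : ∑ i, b i ≤ m) :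
    ∑ i, w i * ((b i : ℝ) - (a i : ℝ)) = w ℓ * m ↔
      a = 0 ∧ ∑ i, b i = m ∧ ∀ i, b i ≠ 0 → w i = w ℓ := by
  have h₁ : 0 ≤ w ℓ * ((m : ℝ) - ((∑ i, b i : ℕ) : ℝ)) :=
    mul_nonneg (hw_pos ℓ).le (sub_nonneg.2 (Nat.cast_le.2 hb))
  have n₂ : ∀ i ∈ Finset.univ, 0 ≤ (w ℓ - w i) * (b i : ℝ) :=
    fun i _ => mul_nonneg (sub_nonneg.2 (hw_le i)) (Nat.cast_nonneg _)
  have n₃ : ∀ i ∈ Finset.univ, 0 ≤ w i * (a i : ℝ) :=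
    fun i _ => mul_nonneg (hw_pos i).le (Nat.cast_nonneg _)
  have h₂ := Finset.sum_nonneg n₂
  have h₃ := Finset.sum_nonneg n₃
  have key := mul_sub_sum_weight w ℓ a b m
  constructor
  · intro h
    have e₁ : w ℓ * ((m : ℝ) - ((∑ i, b i : ℕ) : ℝ)) = 0 := by linarith
    have e₂ : ∑ i, (w ℓ - w i) * (b i : ℝ) = 0 := by linarith
    have e₃ : ∑ i, w i * (a i : ℝ) = 0 := by linarith
    rw [Finset.sum_eq_zero_iff_of_nonneg n₂] at e₂
    rw [Finset.sum_eq_zero_iff_of_nonneg n₃] at e₃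
    refine ⟨?_, ?_, fun i hi => ?_⟩
    · ext i
      have := (mul_eq_zero.1 (e₃ i (Finset.mem_univ i))).resolve_left (hw_pos i).ne'
      exact_mod_cast this
    · have := (mul_eq_zero.1 e₁).resolve_left (hw_pos ℓ).ne'
      exact_mod_cast (sub_eq_zero.1 this).symm
    · have := (mul_eq_zero.1 (e₂ i (Finset.mem_univ i))).resolve_right (Nat.cast_ne_zero.2 hi)
      exact (sub_eq_zero.1 this).symm
  · rintro ⟨rfl, hm, hw⟩
    have e₂ : ∑ i, (w ℓ - w i) * (b i : ℝ) = 0 := by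
      refine Finset.sum_eq_zero fun i _ => ?_
      by_cases hi : b i = 0
      · simp [hi]
      · simp [hw i hi]
    rw [e₂, hm] at key
    simp only [sub_self, mul_zero, Finsupp.coe_zero, Pi.zero_apply, Nat.cast_zero,
      Finset.sum_const_zero, add_zero] at key ⊢
    linarith

/-- For an element `P = ∑ c_{a,b} x^a ∂^b` of the Weyl algebra, encoded by a finitely
supported coefficient function `c`, if `P` has order `m` (hypothesis (i)) and `∂_ℓ^m` is a
monomial of `P` (hypothesis (ii), `ℓ` the last index), and `w` is a weight with
`0 < w i ≤ w ℓ` for all `i`, then the `(−w,w)`-order of `P` equals `w ℓ * m`, a pair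
`(a, b)` in the support attains this maximal weight iff `a = 0`, `∑ i, b i = m`, and
`w i = w ℓ` whenever `b i ≠ 0`; in particular `(0, single ℓ m)` attains the maximum. -/
theorem stmt1 (n : ℕ) (hn : 1 ≤ n) (ℓ : Fin n) (hℓ : (ℓ : ℕ) = n - 1)
    (w : Fin n → ℝ) (hw_pos : ∀ i, 0 < w i) (hw_le : ∀ i, w i ≤ w ℓ)
    (c : (Fin n →₀ ℕ) × (Fin n →₀ ℕ) →₀ ℂ) (m : ℕ)
    (hord : ∀ p ∈ c.support, ∑ i, p.2 i ≤ m)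
    (hmem : ((0 : Fin n →₀ ℕ), Finsupp.single ℓ m) ∈ c.support)
    (hne : c.support.Nonempty) :
    (c.support.sup' hne (fun p => ∑ i, w i * ((p.2 i : ℝ) - (p.1 i : ℝ))) = w ℓ * m) ∧
    (∀ p ∈ c.support,
      (∑ i, w i * ((p.2 i : ℝ) - (p.1 i : ℝ)) = w ℓ * m ↔
        (p.1 = 0 ∧ ∑ i, p.2 i = m ∧ ∀ i, p.2 i ≠ 0 → w i = w ℓ))) ∧
    (∑ i, w i * (((Finsupp.single ℓ m : Fin n →₀ ℕ) i : ℝ) - ((0 : Fin n →₀ ℕ) i : ℝ))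
      = w ℓ * m) := by
  have hmax : ∑ i, w i * (((Finsupp.single ℓ m : Fin n →₀ ℕ) i : ℝ)
      - ((0 : Fin n →₀ ℕ) i : ℝ)) = w ℓ * m := by
    refine (sum_weight_eq_iff hw_pos hw_le (hord _ hmem)).2 ⟨rfl, ?_, fun i hi => ?_⟩
    · simp [Finsupp.single_apply]
    · rw [(Finsupp.single_apply_ne_zero.1 hi).1]
  refine ⟨le_antisymm ?_ ?_, fun p hp => sum_weight_eq_iff hw_pos hw_le (hord p hp), hmax⟩
  · exact Finset.sup'_le _ _ fun p hp => sum_weight_le hw_pos hw_le (hord p hp)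
  · exact hmax.ge.trans
      (Finset.le_sup' (fun p => ∑ i, w i * ((p.2 i : ℝ) - (p.1 i : ℝ))) hmem)
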